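/- arXiv:1901.08978 — 3 statements merged into one kernel-verified Lean document; each statement's English description precedes it below -/
import Mathlib

section
/- Let M be an n×n row-stochastic real matrix (all entries nonnegative, each row summing to 1), r ∈ ℝ^n, and suppose there exist v ∈ ℝ and H ∈ ℝ^n satisfying the Poisson equation H(i) + v = r(i) + Σ_{j=1}^n M(i,j) H(j) for every i. Then for every i, the Cesàro averages converge to v: (1/T) Σ_{k=0}^{T−1} (M^k r)(i) → v as T → ∞. In particular, under the Poisson equation the long-run expected average reward of the Markov chain with transition matrix M and per-step reward r is v, independently of the initial state. -/
open Filter Matrix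

/-- If `M` is an `n × n` row-stochastic matrix and `(v, H)` solves the
Poisson equation `H i + v = r i + ∑ j, M i j * H j`, then for every initial state `i`
the Cesàro averages of the expected rewards converge to `v`:
`(1/T) ∑_{k < T} (M^k r) i → v`. -/
theorem stmt6 {n : ℕ} (M : Matrix (Fin n) (Fin n) ℝ) (r H : Fin n → ℝ) (v : ℝ)
    (hM0 : ∀ i j, 0 ≤ M i j) (hM1 : ∀ i, ∑ j, M i j = 1)
    (hPoisson : ∀ i, H i + v = r i + ∑ j, M i j * H j) :
    ∀ i, Tendsto
      (fun T : ℕ => (1 / (T : ℝ)) * ∑ k ∈ Finset.range T, ((M ^ k).mulVec r) i)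
      atTop (nhds v) := by
  have hone : ∀ k : ℕ, (M ^ k).mulVec (fun _ => v) = fun _ => v := by
    intro k
    induction k with
    | zero => simp
    | succ k ih =>
      rw [pow_succ, ← Matrix.mulVec_mulVec]
      have : M.mulVec (fun _ => v) = fun _ => v := by
        funext i
        simp [Matrix.mulVec, dotProduct, ← Finset.sum_mul, hM1]
      rw [this, ih]
  have hbd : ∀ (k : ℕ) (i : Fin n), |((M ^ k).mulVec H) i| ≤ ‖H‖ := by
    intro k
    induction k with
    | zero =>
      intro i
      simpa using norm_le_pi_norm H i
    | succ k ih =>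
      intro i
      rw [pow_succ', ← Matrix.mulVec_mulVec]
      calc |(M.mulVec ((M ^ k).mulVec H)) i|
          ≤ ∑ j, |M i j * ((M ^ k).mulVec H) j| := by
              simp only [Matrix.mulVec, dotProduct]
              exact Finset.abs_sum_le_sum_abs _ _
        _ ≤ ∑ j, M i j * ‖H‖ := by
          apply Finset.sum_le_sum
          intro j _
          rw [abs_mul, abs_of_nonneg (hM0 i j)]
          exact mul_le_mul_of_nonneg_left (ih j) (hM0 i j)
        _ = ‖H‖ := by rw [← Finset.sum_mul, hM1, one_mul]
  have hr : r = H + (fun _ => v) - M.mulVec H := by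
    funext i
    have := hPoisson i
    simp only [Pi.add_apply, Pi.sub_apply, Matrix.mulVec, dotProduct]
    linarith
  intro i
  have hsum : ∀ T : ℕ, ∑ k ∈ Finset.range T, ((M ^ k).mulVec r) i
      = T * v + (H i - ((M ^ T).mulVec H) i) := by
    intro T
    induction T with
    | zero => simp
    | succ T ih =>
      have hT : ((M ^ T).mulVec r) i
          = ((M ^ T).mulVec H) i + v - ((M ^ (T + 1)).mulVec H) i := by
        rw [hr, Matrix.mulVec_sub, Matrix.mulVec_add, hone, Matrix.mulVec_mulVec, ← pow_succ]
        simp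
      rw [Finset.sum_range_succ, ih, hT]
      push_cast
      ring
  have hz : Tendsto (fun T : ℕ => (1 / (T : ℝ)) * (H i - ((M ^ T).mulVec H) i))
      atTop (nhds 0) := by
    apply squeeze_zero_norm (a := fun T : ℕ => (2 * ‖H‖) / (T : ℝ))
    · intro T
      have h1 := hbd T i
      have h0 : |H i| ≤ ‖H‖ := norm_le_pi_norm H i
      have h2 : |H i - ((M ^ T).mulVec H) i| ≤ 2 * ‖H‖ := by
        have := abs_sub (H i) (((M ^ T).mulVec H) i)
        linarith
      rw [Real.norm_eq_abs, abs_mul, abs_of_nonneg (by positivity : (0 : ℝ) ≤ 1 / (T : ℝ)),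
        one_div_mul_eq_div]
      gcongr
    · exact tendsto_const_div_atTop_nhds_zero_nat _
  have hv := hz.const_add v
  rw [add_zero] at hv
  refine hv.congr' ?_
  filter_upwards [eventually_gt_atTop 0] with T hT
  have : (T : ℝ) ≠ 0 := by positivity
  rw [hsum]
  field_simp
end

section
/- Let (S, A, O, P, R) be a zero-sum Markov-Bandit game with R bounded, and let T be the maximin operator on ℝ^{S×A×O} defined by (T Q)(s,a,o) = Σ_{s′∈S} P(s,a,s′) · max_{p∈Δ(A)} min_{o′∈O} ( R(s,a,o′) + Σ_{a′∈A} p(a′) Q(s′,a′,o′) ). Then T is nonexpansive in the span seminorm: for all Q₁, Q₂ : S×A×O → ℝ, ‖T Q₁ − T Q₂‖_s ≤ ‖Q₁ − Q₂‖_s, where ‖Q‖_s = max_{s,a,o} Q(s,a,o) − min_{s,a,o} Q(s,a,o). -/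
open Finset

/-- The maximin operator of a zero-sum Markov-Bandit game:
`(T Q)(s,a,o) = ∑_{s'} P(s,a,s') · max_{p ∈ Δ(A)} min_{o'} (R(s,a,o') + ∑_{a'} p(a') Q(s',a',o'))`.
(The outer `⨆` over the compact simplex `Δ(A)` is an attained maximum.) -/
noncomputable def Tmaximin {S A O : Type*} [Fintype S] [Fintype A] [Fintype O]
    [Nonempty A] [Nonempty O]
    (P : S → A → S → ℝ) (R : S → A → O → ℝ) (Q : S → A → O → ℝ) :
    S → A → O → ℝ :=
  fun s a _ => ∑ s' : S, P s a s' *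
    ⨆ p : stdSimplex ℝ A,
      Finset.univ.inf' Finset.univ_nonempty fun o' : O =>
        R s a o' + ∑ a' : A, (p : A → ℝ) a' * Q s' a' o'

/-- The span seminorm `‖Q‖_s = max Q − min Q` of `Q : S × A × O → ℝ`. -/
noncomputable def spanSeminorm {S A O : Type*} [Fintype S] [Fintype A] [Fintype O]
    [Nonempty S] [Nonempty A] [Nonempty O] (Q : S → A → O → ℝ) : ℝ :=
  (Finset.univ.sup' Finset.univ_nonempty fun x : S × A × O => Q x.1 x.2.1 x.2.2) -
    Finset.univ.inf' Finset.univ_nonempty fun x : S × A × O => Q x.1 x.2.1 x.2.2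

theorem Tmaximin_le_add {S A O : Type*} [Fintype S] [Fintype A] [Fintype O]
    [Nonempty A] [Nonempty O]
    (P : S → A → S → ℝ)
    (hP : ∀ s a, (∀ s', 0 ≤ P s a s') ∧ ∑ s' : S, P s a s' = 1)
    (R : S → A → O → ℝ) (Q₁ Q₂ : S → A → O → ℝ) (M : ℝ)
    (h : ∀ s a o, Q₁ s a o ≤ Q₂ s a o + M) (s : S) (a : A) (o : O) :
    Tmaximin P R Q₁ s a o ≤ Tmaximin P R Q₂ s a o + M := by
  classical
  unfold Tmaximin
  have hM : M = ∑ s' : S, P s a s' * M := by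
    rw [← Finset.sum_mul, (hP s a).2, one_mul]
  conv_rhs => rw [hM]
  rw [← Finset.sum_add_distrib]
  refine Finset.sum_le_sum fun s' _ => ?_
  rw [← mul_add]
  refine mul_le_mul_of_nonneg_left ?_ ((hP s a).1 s')
  have : Nonempty (stdSimplex ℝ A) :=
    ⟨⟨_, single_mem_stdSimplex ℝ (Classical.arbitrary A)⟩⟩
  refine ciSup_le fun p => ?_
  have hb : BddAbove (Set.range fun p : stdSimplex ℝ A =>
      Finset.univ.inf' Finset.univ_nonempty fun o' : O =>
        R s a o' + ∑ a' : A, (p : A → ℝ) a' * Q₂ s' a' o') := by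
    refine ⟨R s a o + ∑ a' : A, |Q₂ s' a' o|, ?_⟩
    rintro _ ⟨q, rfl⟩
    refine (Finset.inf'_le _ (Finset.mem_univ o)).trans ?_
    refine add_le_add le_rfl (Finset.sum_le_sum fun a' _ => ?_)
    have h0 : 0 ≤ (q : A → ℝ) a' := q.2.1 a'
    have h1 : (q : A → ℝ) a' ≤ 1 := by
      rw [← q.2.2]
      exact Finset.single_le_sum (fun i _ => q.2.1 i) (Finset.mem_univ a')
    calc (q : A → ℝ) a' * Q₂ s' a' o ≤ (q : A → ℝ) a' * |Q₂ s' a' o| :=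
          mul_le_mul_of_nonneg_left (le_abs_self _) h0
      _ ≤ 1 * |Q₂ s' a' o| := mul_le_mul_of_nonneg_right h1 (abs_nonneg _)
      _ = _ := one_mul _
  rw [← sub_le_iff_le_add]
  refine le_trans ?_ (le_ciSup hb p)
  refine Finset.le_inf' _ _ fun o' _ => ?_
  rw [sub_le_iff_le_add]
  refine (Finset.inf'_le _ (Finset.mem_univ o')).trans ?_
  rw [add_assoc]
  refine add_le_add le_rfl ?_
  have hM' : M = ∑ a' : A, (p : A → ℝ) a' * M := by
    have h1 : ∑ a' : A, (p : A → ℝ) a' = 1 := p.2.2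
    rw [← Finset.sum_mul, h1, one_mul]
  conv_rhs => rw [hM']
  rw [← Finset.sum_add_distrib]
  refine Finset.sum_le_sum fun a' _ => ?_
  rw [← mul_add]
  exact mul_le_mul_of_nonneg_left (h s' a' o') (p.2.1 a')

/-- For a zero-sum Markov-Bandit game `(S, A, O, P, R)` with `R` bounded,
the maximin operator `T` is nonexpansive in the span seminorm:
`‖T Q₁ − T Q₂‖_s ≤ ‖Q₁ − Q₂‖_s`. -/
theorem stmt8 {S A O : Type*} [Fintype S] [Fintype A] [Fintype O]
    [Nonempty S] [Nonempty A] [Nonempty O]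
    (P : S → A → S → ℝ)
    (hP : ∀ s a, (∀ s', 0 ≤ P s a s') ∧ ∑ s' : S, P s a s' = 1)
    (R : S → A → O → ℝ) (c : ℝ) (hR : ∀ s a o, |R s a o| ≤ c)
    (Q₁ Q₂ : S → A → O → ℝ) :
    spanSeminorm (fun s a o => Tmaximin P R Q₁ s a o - Tmaximin P R Q₂ s a o) ≤
      spanSeminorm (fun s a o => Q₁ s a o - Q₂ s a o) := by
  unfold spanSeminorm
  refine sub_le_sub ?_ ?_
  · refine Finset.sup'_le _ _ fun x _ => ?_
    rw [sub_le_iff_le_add']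
    refine Tmaximin_le_add P hP R Q₁ Q₂ _ (fun s a o => ?_) _ _ _
    rw [← sub_le_iff_le_add']
    exact Finset.le_sup' (fun x : S × A × O => Q₁ x.1 x.2.1 x.2.2 - Q₂ x.1 x.2.1 x.2.2)
      (Finset.mem_univ (s, a, o))
  · refine Finset.le_inf' _ _ fun x _ => ?_
    have key := Tmaximin_le_add P hP R Q₂ Q₁
      (-(Finset.univ.inf' Finset.univ_nonempty
        fun x : S × A × O => Q₁ x.1 x.2.1 x.2.2 - Q₂ x.1 x.2.1 x.2.2))
      (fun s a o => by
        have := Finset.inf'_le (fun x : S × A × O => Q₁ x.1 x.2.1 x.2.2 - Q₂ x.1 x.2.1 x.2.2)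
          (Finset.mem_univ (s, a, o))
        dsimp only at this
        linarith) x.1 x.2.1 x.2.2
    linarith
end

section
/- Let (S, A, O, P, R) be a zero-sum Markov-Bandit game with R bounded, and let T be the maximin operator (T Q)(s,a,o) = Σ_{s′∈S} P(s,a,s′) · max_{p∈Δ(A)} min_{o′∈O} ( R(s,a,o′) + Σ_{a′} p(a′) Q(s′,a′,o′) ). Then for every Q : S×A×O → ℝ the scaling limit of T exists: for each (s,a,o), T(z·Q)(s,a,o)/z converges as z → ∞ to (T₀ Q)(s,a,o) := Σ_{s′∈S} P(s,a,s′) · max_{p∈Δ(A)} min_{o′∈O} Σ_{a′} p(a′) Q(s′,a′,o′); in particular, for h(Q) = T(Q) − Q − f(Q)·e with f : ℝ^{S×A×O} → ℝ satisfying f(cQ) = c f(Q), the limit h_∞(Q) = lim_{z→∞} h(zQ)/z exists and equals T₀(Q) − Q − f(Q)·e. -/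
open Finset Filter

/-- The reward-free scaling limit operator
`(T₀ Q)(s,a,o) = ∑_{s'} P(s,a,s') · max_{p ∈ Δ(A)} min_{o'} ∑_{a'} p(a') Q(s',a',o')`. -/
noncomputable def Tzero {S A O : Type*} [Fintype S] [Fintype A] [Fintype O]
    [Nonempty A] [Nonempty O]
    (P : S → A → S → ℝ) (Q : S → A → O → ℝ) : S → A → O → ℝ :=
  fun s a _ => ∑ s' : S, P s a s' *
    ⨆ p : stdSimplex ℝ A,
      Finset.univ.inf' Finset.univ_nonempty fun o' : O =>
        ∑ a' : A, (p : A → ℝ) a' * Q s' a' o'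

theorem stmt15_aux {A O : Type*} [Fintype A] [Fintype O] [Nonempty A] [Nonempty O]
    (r : O → ℝ) (c : ℝ) (hr : ∀ o, |r o| ≤ c) (q : A → O → ℝ) (z : ℝ) (hz : 0 < z) :
    |(⨆ p : stdSimplex ℝ A, Finset.univ.inf' Finset.univ_nonempty fun o' : O =>
        r o' + ∑ a' : A, (p : A → ℝ) a' * (z * q a' o'))
      - z * ⨆ p : stdSimplex ℝ A, Finset.univ.inf' Finset.univ_nonempty fun o' : O =>
        ∑ a' : A, (p : A → ℝ) a' * q a' o'| ≤ c := by
  classical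
  have : Nonempty (stdSimplex ℝ A) :=
    ⟨⟨Pi.single (Classical.arbitrary A) 1, single_mem_stdSimplex ℝ _⟩⟩
  set g : stdSimplex ℝ A → ℝ := fun p => Finset.univ.inf' Finset.univ_nonempty fun o' : O =>
        ∑ a' : A, (p : A → ℝ) a' * q a' o' with hg
  set F : stdSimplex ℝ A → ℝ := fun p => Finset.univ.inf' Finset.univ_nonempty fun o' : O =>
        r o' + ∑ a' : A, (p : A → ℝ) a' * (z * q a' o') with hF
  have hsum : ∀ (p : stdSimplex ℝ A) (o : O),
      ∑ a' : A, (p : A → ℝ) a' * (z * q a' o) = z * ∑ a' : A, (p : A → ℝ) a' * q a' o := by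
    intro p o
    rw [Finset.mul_sum]
    exact Finset.sum_congr rfl fun a _ => by ring
  have h1 : ∀ p, F p ≤ z * g p + c := by
    intro p
    obtain ⟨o, -, ho⟩ := Finset.exists_mem_eq_inf' (Finset.univ_nonempty (α := O))
      (fun o' : O => ∑ a' : A, (p : A → ℝ) a' * q a' o')
    have e : g p = ∑ a' : A, (p : A → ℝ) a' * q a' o := ho
    have h : F p ≤ r o + ∑ a' : A, (p : A → ℝ) a' * (z * q a' o) :=
      Finset.inf'_le _ (Finset.mem_univ o)
    rw [hsum, ← e] at h
    linarith [(abs_le.1 (hr o)).2]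
  have h2 : ∀ p, z * g p ≤ F p + c := by
    intro p
    obtain ⟨o, -, ho⟩ := Finset.exists_mem_eq_inf' (Finset.univ_nonempty (α := O))
      (fun o' : O => r o' + ∑ a' : A, (p : A → ℝ) a' * (z * q a' o'))
    have e : F p = r o + ∑ a' : A, (p : A → ℝ) a' * (z * q a' o) := ho
    have h : g p ≤ ∑ a' : A, (p : A → ℝ) a' * q a' o :=
      Finset.inf'_le _ (Finset.mem_univ o)
    rw [hsum] at e
    have := mul_le_mul_of_nonneg_left h hz.le
    linarith [(abs_le.1 (hr o)).1]
  have bg : BddAbove (Set.range g) := by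
    refine ⟨∑ a : A, |q a (Classical.arbitrary O)|, ?_⟩
    rintro _ ⟨p, rfl⟩
    refine (Finset.inf'_le _ (Finset.mem_univ (Classical.arbitrary O))).trans ?_
    refine Finset.sum_le_sum fun a _ => ?_
    have p0 : 0 ≤ (p : A → ℝ) a := p.2.1 a
    have p1 : (p : A → ℝ) a ≤ 1 := by
      rw [← p.2.2]
      exact Finset.single_le_sum (fun i _ => p.2.1 i) (Finset.mem_univ a)
    calc (p : A → ℝ) a * q a (Classical.arbitrary O)
        ≤ (p : A → ℝ) a * |q a (Classical.arbitrary O)| :=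
          mul_le_mul_of_nonneg_left (le_abs_self _) p0
      _ ≤ 1 * |q a (Classical.arbitrary O)| :=
          mul_le_mul_of_nonneg_right p1 (abs_nonneg _)
      _ = _ := one_mul _
  have h3 : ∀ p, F p ≤ z * (⨆ p, g p) + c := fun p =>
    (h1 p).trans (by
      have := mul_le_mul_of_nonneg_left (le_ciSup bg p) hz.le
      linarith)
  have bF : BddAbove (Set.range F) := by
    refine ⟨z * (⨆ p, g p) + c, ?_⟩
    rintro _ ⟨p, rfl⟩
    exact h3 p
  have h4 : (⨆ p, F p) ≤ z * (⨆ p, g p) + c := ciSup_le h3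
  have h5 : (⨆ p, g p) ≤ ((⨆ p, F p) + c) / z := by
    refine ciSup_le fun p => ?_
    rw [le_div_iff₀ hz]
    have := le_ciSup bF p
    linarith [h2 p]
  rw [le_div_iff₀ hz] at h5
  exact abs_le.2 ⟨by linarith, by linarith⟩

/-- For a zero-sum Markov-Bandit game with bounded `R`, the scaling limit of
the maximin operator exists: `T(z·Q)(s,a,o)/z → (T₀ Q)(s,a,o)` as `z → ∞`; in particular,
for `h(Q) = T(Q) − Q − f(Q)·e` with `f` positively homogeneous (`f(cQ) = c f(Q)`), the limit
`h_∞(Q) = lim_{z→∞} h(zQ)/z` exists and equals `T₀(Q) − Q − f(Q)·e`. -/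
theorem stmt15 {S A O : Type*} [Fintype S] [Fintype A] [Fintype O]
    [Nonempty A] [Nonempty O]
    (P : S → A → S → ℝ)
    (hP : ∀ s a, (∀ s', 0 ≤ P s a s') ∧ ∑ s' : S, P s a s' = 1)
    (R : S → A → O → ℝ) (c : ℝ) (hR : ∀ s a o, |R s a o| ≤ c) :
    (∀ (Q : S → A → O → ℝ) (s : S) (a : A) (o : O),
      Tendsto (fun z : ℝ =>
          Tmaximin P R (fun s' a' o' => z * Q s' a' o') s a o / z)
        atTop (nhds (Tzero P Q s a o))) ∧
      ∀ f : (S → A → O → ℝ) → ℝ,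
        (∀ (cc : ℝ) (Q : S → A → O → ℝ), f (fun s a o => cc * Q s a o) = cc * f Q) →
        ∀ (Q : S → A → O → ℝ) (s : S) (a : A) (o : O),
          Tendsto (fun z : ℝ =>
              (Tmaximin P R (fun s' a' o' => z * Q s' a' o') s a o
                - z * Q s a o - f (fun s' a' o' => z * Q s' a' o')) / z)
            atTop (nhds (Tzero P Q s a o - Q s a o - f Q)) := by
  have key : ∀ (Q : S → A → O → ℝ) (s : S) (a : A) (o : O),
      Tendsto (fun z : ℝ =>
          Tmaximin P R (fun s' a' o' => z * Q s' a' o') s a o / z)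
        atTop (nhds (Tzero P Q s a o)) := by
    intro Q s a o
    have hb : ∀ z : ℝ, 0 < z →
        |Tmaximin P R (fun s' a' o' => z * Q s' a' o') s a o - z * Tzero P Q s a o| ≤ c := by
      intro z hz
      unfold Tmaximin Tzero
      rw [Finset.mul_sum, ← Finset.sum_sub_distrib]
      refine (Finset.abs_sum_le_sum_abs _ _).trans ?_
      calc _ ≤ ∑ s' : S, P s a s' * c := by
            refine Finset.sum_le_sum fun s' _ => ?_
            rw [mul_left_comm, ← mul_sub, abs_mul, abs_of_nonneg ((hP s a).1 s')]
            exact mul_le_mul_of_nonneg_left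
              (stmt15_aux (R s a) c (hR s a) (Q s') z hz) ((hP s a).1 s')
        _ = c := by rw [← Finset.sum_mul, (hP s a).2, one_mul]
    rw [tendsto_iff_dist_tendsto_zero]
    refine squeeze_zero' (g := fun z : ℝ => c / z) (Eventually.of_forall fun _ => dist_nonneg) ?_
      (tendsto_const_nhds.div_atTop tendsto_id)
    filter_upwards [eventually_gt_atTop (0 : ℝ)] with z hz
    rw [Real.dist_eq, le_div_iff₀ hz]
    nth_rewrite 3 [← abs_of_pos hz]
    rw [← abs_mul, sub_mul, div_mul_cancel₀ _ hz.ne', mul_comm _ z]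
    exact hb z hz
  refine ⟨key, ?_⟩
  intro f hf Q s a o
  refine (((key Q s a o).sub_const (Q s a o)).sub_const (f Q)).congr' ?_
  filter_upwards [eventually_gt_atTop (0 : ℝ)] with z hz
  rw [hf]
  field_simp
end
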